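/- arXiv:1906.01694 — 2 statements merged into one kernel-verified Lean document; each statement's English description precedes it below -/
import Mathlib

section
/- Let (T¹,T²) ∈ ℝ² with T¹ ≠ 0, and consider on ℝ² the connection with constant Christoffel symbols Γ_{11}¹ = 1, Γ_{12}¹ = T¹, Γ_{12}² = 1 + T², Γ_{21}¹ = −T¹, Γ_{21}² = 1 − T², and all other Γ_{ij}^k = 0 (the model M₁⁶(T) with T¹ ≠ 0). Then a smooth vector field X on ℝ² is an affine Killing vector field for this connection if and only if X lies in the ℝ-linear span of the two constant vector fields (1,0) and (0,1). -/
open Real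

/-- The partial derivative `∂f/∂x^i` of a function on `ℝ²` (points are `Fin 2 → ℝ`). -/
noncomputable def pd (f : (Fin 2 → ℝ) → ℝ) (i : Fin 2) (p : Fin 2 → ℝ) : ℝ :=
  fderiv ℝ f p (Pi.single i 1)

/-- The affine Killing operator
`K^Γ_{ij}^k(v) = ∂_i∂_j v^k + v^l ∂_l Γ_{ij}^k − Γ_{ij}^l ∂_l v^k + Γ_{il}^k ∂_j v^l + Γ_{lj}^k ∂_i v^l`
(summation over `l`). -/
noncomputable def killingOp (Γ : Fin 2 → Fin 2 → Fin 2 → (Fin 2 → ℝ) → ℝ)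
    (v : Fin 2 → (Fin 2 → ℝ) → ℝ) (i j k : Fin 2) (p : Fin 2 → ℝ) : ℝ :=
  pd (fun q => pd (v k) j q) i p
    + (∑ l : Fin 2, v l p * pd (Γ i j k) l p)
    - (∑ l : Fin 2, Γ i j l p * pd (v k) l p)
    + (∑ l : Fin 2, Γ i l k p * pd (v l) j p)
    + (∑ l : Fin 2, Γ l j k p * pd (v l) i p)

/-- `v` is an affine Killing vector field for the connection `Γ` on `U`:
all eight affine Killing equations hold on `U`. -/
def IsAffineKilling (U : Set (Fin 2 → ℝ))
    (Γ : Fin 2 → Fin 2 → Fin 2 → (Fin 2 → ℝ) → ℝ)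
    (v : Fin 2 → (Fin 2 → ℝ) → ℝ) : Prop :=
  ∀ i j k : Fin 2, ∀ p ∈ U, killingOp Γ v i j k p = 0

theorem pd_const (c : ℝ) (i : Fin 2) (p : Fin 2 → ℝ) : pd (fun _ => c) i p = 0 := by
  simp [pd]

theorem pd_const_mul (c : ℝ) (f : (Fin 2 → ℝ) → ℝ) (i : Fin 2) (p : Fin 2 → ℝ) :
    pd (fun q => c * f q) i p = c * pd f i p := by
  exact DFunLike.congr_fun (congrFun (fderiv_const_smul_field (𝕜 := ℝ) (f := f) c) p)
    (Pi.single i 1)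

theorem pd_comm {f : (Fin 2 → ℝ) → ℝ} (hf : ContDiff ℝ 2 f) (i j : Fin 2) (p : Fin 2 → ℝ) :
    pd (fun q => pd f j q) i p = pd (fun q => pd f i q) j p := by
  have hd : DifferentiableAt ℝ (fderiv ℝ f) p :=
    (hf.fderiv_right (m := 1) (by norm_num)).differentiable (by norm_num) p
  have key (k l : Fin 2) : pd (fun q => pd f l q) k p =
      fderiv ℝ (fderiv ℝ f) p (Pi.single k 1) (Pi.single l 1) := by
    simp only [pd]
    rw [fderiv_clm_apply hd (differentiableAt_const _)]
    simp
  rw [key, key]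
  exact (hf.contDiffAt.isSymmSndFDerivAt (by simp)).eq _ _

theorem eq_of_pd_eq_zero {f : (Fin 2 → ℝ) → ℝ} (hf : Differentiable ℝ f)
    (h : ∀ i p, pd f i p = 0) (p q : Fin 2 → ℝ) : f p = f q := by
  refine is_const_of_fderiv_eq_zero hf (fun x => ?_) p q
  apply ContinuousLinearMap.coe_injective
  refine LinearMap.pi_ext' fun i => LinearMap.ext_ring ?_
  simpa [pd] using h i x

theorem stmt5 (T1 T2 : ℝ) (hT : T1 ≠ 0)
    (v : Fin 2 → (Fin 2 → ℝ) → ℝ)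
    (hv : ∀ i : Fin 2, ContDiff ℝ (⊤ : ℕ∞) (v i)) :
    IsAffineKilling Set.univ
      (fun i j k => fun _ : Fin 2 → ℝ =>
        ![![![(1 : ℝ), 0], ![T1, 1 + T2]], ![![-T1, 1 - T2], ![0, 0]]] i j k) v
    ↔ ∃ a b : ℝ, ∀ p : Fin 2 → ℝ, v 0 p = a ∧ v 1 p = b := by
  constructor
  · intro h
    have eqn (i j k : Fin 2) (p : Fin 2 → ℝ) := h i j k p (Set.mem_univ p)
    simp only [killingOp, pd_const, Fin.sum_univ_two] at eqn
    have comm (k : Fin 2) := pd_comm ((hv k).of_le (WithTop.coe_le_coe.mpr le_top)) 0 1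
    have tor₁ (p : Fin 2 → ℝ) : T1 * pd (v 1) 1 p = T2 * pd (v 0) 1 p := by
      have h₁ := eqn 0 1 0 p
      have h₂ := eqn 1 0 0 p
      have h₃ := comm 0 p
      simp at h₁ h₂
      linarith
    have tor₀ (p : Fin 2 → ℝ) : T1 * pd (v 1) 0 p = T2 * pd (v 0) 0 p := by
      have h₁ := eqn 0 1 1 p
      have h₂ := eqn 1 0 1 p
      have h₃ := comm 1 p
      simp at h₁ h₂
      linarith
    have dtor₁ (i : Fin 2) (p : Fin 2 → ℝ) :
        T1 * pd (fun q => pd (v 1) 1 q) i p = T2 * pd (fun q => pd (v 0) 1 q) i p := by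
      rw [← pd_const_mul, ← pd_const_mul, funext tor₁]
    have u₁ (p : Fin 2 → ℝ) : pd (v 0) 1 p = 0 := by
      have h₁ := eqn 1 1 0 p
      have h₂ := eqn 1 1 1 p
      have h₃ := dtor₁ 1 p
      have h₄ := tor₁ p
      simp at h₁ h₂
      refine (mul_eq_zero.mp ?_).resolve_left hT
      grind
    have u₀ (p : Fin 2 → ℝ) : pd (v 0) 0 p = 0 := by
      have h₁ := eqn 0 1 0 p
      have h₂ := eqn 0 1 1 p
      have h₃ := dtor₁ 0 p
      have h₄ := tor₁ p
      have h₅ := tor₀ p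
      have h₆ := u₁ p
      simp at h₁ h₂
      refine (mul_eq_zero.mp ?_).resolve_left hT
      grind
    have w₁ (p : Fin 2 → ℝ) : pd (v 1) 1 p = 0 := by simpa [u₁, hT] using tor₁ p
    have w₀ (p : Fin 2 → ℝ) : pd (v 1) 0 p = 0 := by simpa [u₀, hT] using tor₀ p
    have diff (k : Fin 2) : Differentiable ℝ (v k) := (hv k).differentiable (by simp)
    exact ⟨v 0 0, v 1 0, fun p =>
      ⟨eq_of_pd_eq_zero (diff 0) (Fin.forall_fin_two.mpr ⟨u₀, u₁⟩) p 0,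
        eq_of_pd_eq_zero (diff 1) (Fin.forall_fin_two.mpr ⟨w₀, w₁⟩) p 0⟩⟩
  · rintro ⟨a, b, h⟩ i j k p -
    have hpd (l m : Fin 2) (q : Fin 2 → ℝ) : pd (v l) m q = 0 := by
      have h₀ : v 0 = fun _ => a := funext fun q => (h q).1
      have h₁ : v 1 = fun _ => b := funext fun q => (h q).2
      fin_cases l
      · simp [h₀, pd_const]
      · simp [h₁, pd_const]
    simp [killingOp, hpd, pd_const]
end

section
/- Let c ∈ ℝ and T¹ ∈ ℝ, and consider on ℝ² the connection with constant Christoffel symbols Γ_{11}¹ = 1, Γ_{12}¹ = T¹, Γ_{21}¹ = −T¹, Γ_{22}¹ = 1 + c², Γ_{22}² = 2c, and all other Γ_{ij}^k = 0 (the model M₅⁴(c;(T¹,0))). Then a smooth vector field X on ℝ² is an affine Killing vector field for this connection if and only if X lies in the ℝ-linear span of the four vector fields (1,0), (0,1), (e^{−x¹+cx²} cos(x²), 0), and (e^{−x¹+cx²} sin(x²), 0). -/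
open Real

/-- `f` is differentiable at `p` with partial derivatives `a` and `b`. -/
def HasPartials (f : (Fin 2 → ℝ) → ℝ) (a b : ℝ) (p : Fin 2 → ℝ) : Prop :=
  HasFDerivAt f (a • ContinuousLinearMap.proj (R := ℝ) (φ := fun _ : Fin 2 => ℝ) 0
    + b • ContinuousLinearMap.proj (R := ℝ) (φ := fun _ : Fin 2 => ℝ) 1) p

namespace HasPartials

variable {f g : (Fin 2 → ℝ) → ℝ} {a b a' b' : ℝ} {p : Fin 2 → ℝ}

theorem congr_partials (h : HasPartials f a b p) (ha : a = a') (hb : b = b') :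
    HasPartials f a' b' p := by
  subst ha hb
  exact h

theorem pd_zero (h : HasPartials f a b p) : pd f 0 p = a := by
  have h' : fderiv ℝ f p = _ := HasFDerivAt.fderiv h
  simp [pd, h']

theorem pd_one (h : HasPartials f a b p) : pd f 1 p = b := by
  have h' : fderiv ℝ f p = _ := HasFDerivAt.fderiv h
  simp [pd, h']

theorem const (r : ℝ) : HasPartials (fun _ => r) 0 0 p := by
  simpa [HasPartials] using hasFDerivAt_const r p

theorem coord_zero : HasPartials (fun q => q 0) 1 0 p := by
  simpa [HasPartials] using hasFDerivAt_apply (𝕜 := ℝ) (F' := fun _ : Fin 2 => ℝ) 0 p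

theorem coord_one : HasPartials (fun q => q 1) 0 1 p := by
  simpa [HasPartials] using hasFDerivAt_apply (𝕜 := ℝ) (F' := fun _ : Fin 2 => ℝ) 1 p

theorem add (hf : HasPartials f a b p) (hg : HasPartials g a' b' p) :
    HasPartials (fun q => f q + g q) (a + a') (b + b') p := by
  refine (HasFDerivAt.add hf hg).congr_fderiv ?_
  module

theorem mul (hf : HasPartials f a b p) (hg : HasPartials g a' b' p) :
    HasPartials (fun q => f q * g q) (f p * a' + g p * a) (f p * b' + g p * b) p := by
  refine (HasFDerivAt.mul hf hg).congr_fderiv ?_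
  module

theorem comp {φ : ℝ → ℝ} {r : ℝ} (hφ : HasDerivAt φ r (f p)) (hf : HasPartials f a b p) :
    HasPartials (fun q => φ (f q)) (r * a) (r * b) p := by
  refine (hφ.comp_hasFDerivAt p hf).congr_fderiv ?_
  module

end HasPartials

theorem Differentiable.hasPartials {f : (Fin 2 → ℝ) → ℝ} (hf : Differentiable ℝ f)
    (p : Fin 2 → ℝ) : HasPartials f (pd f 0 p) (pd f 1 p) p := by
  refine (hf p).hasFDerivAt.congr_fderiv ?_
  ext x
  have hx : x = x 0 • Pi.single 0 1 + x 1 • Pi.single 1 1 := by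
    ext i
    fin_cases i <;> simp
  conv_lhs => rw [hx]
  simp [pd, mul_comm]

theorem ContDiff.pd {f : (Fin 2 → ℝ) → ℝ} (hf : ContDiff ℝ (⊤ : ℕ∞) f) (i : Fin 2) :
    ContDiff ℝ (⊤ : ℕ∞) (pd f i) :=
  (hf.fderiv_right (m := (⊤ : ℕ∞)) (by simp)).clm_apply contDiff_const

theorem ContDiff.hasPartials {f : (Fin 2 → ℝ) → ℝ} (hf : ContDiff ℝ (⊤ : ℕ∞) f)
    (p : Fin 2 → ℝ) : HasPartials f (_root_.pd f 0 p) (_root_.pd f 1 p) p :=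
  (hf.differentiable (by simp)).hasPartials p

theorem pd_pd_comm {f : (Fin 2 → ℝ) → ℝ} (hf : ContDiff ℝ (⊤ : ℕ∞) f) (i j : Fin 2)
    (p : Fin 2 → ℝ) : pd (pd f j) i p = pd (pd f i) j p := by
  have hd : DifferentiableAt ℝ (fderiv ℝ f) p :=
    (hf.fderiv_right (m := (⊤ : ℕ∞)) (by simp)).differentiable (by simp) p
  have key : ∀ k l : Fin 2,
      pd (pd f k) l p = fderiv ℝ (fderiv ℝ f) p (Pi.single l 1) (Pi.single k 1) := by
    intro k l
    change fderiv ℝ (fun q => fderiv ℝ f q (Pi.single k 1)) p (Pi.single l 1) = _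
    rw [fderiv_clm_apply hd (differentiableAt_const _)]
    simp
  rw [key, key]
  exact (hf.contDiffAt.isSymmSndFDerivAt (by
    simpa using (mod_cast le_top : ((2 : ℕ∞) : WithTop ℕ∞) ≤ ((⊤ : ℕ∞) : WithTop ℕ∞)))).eq _ _

theorem eq_const_of_hasPartials_zero {f : (Fin 2 → ℝ) → ℝ} (hf : ∀ p, HasPartials f 0 0 p)
    (p : Fin 2 → ℝ) : f p = f 0 := by
  have h : ∀ q, HasFDerivAt f (0 : (Fin 2 → ℝ) →L[ℝ] ℝ) q := fun q =>
    (hf q : HasFDerivAt _ _ _).congr_fderiv (by simp)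
  exact is_const_of_fderiv_eq_zero (𝕜 := ℝ) (fun q => (h q).differentiableAt)
    (fun q => (h q).fderiv) p 0

/-- The functions `e^{-x¹+cx²} (d cos x² + e sin x²)` are closed under partial derivatives. -/
theorem hasPartials_exp_trig (c a d e : ℝ) (p : Fin 2 → ℝ) :
    HasPartials (fun q => a + d * (exp (-q 0 + c * q 1) * cos (q 1))
        + e * (exp (-q 0 + c * q 1) * sin (q 1)))
      (0 + (-d) * (exp (-p 0 + c * p 1) * cos (p 1))
        + (-e) * (exp (-p 0 + c * p 1) * sin (p 1)))
      (0 + (c * d + e) * (exp (-p 0 + c * p 1) * cos (p 1))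
        + (c * e - d) * (exp (-p 0 + c * p 1) * sin (p 1))) p := by
  have hlin : HasPartials (fun q => -q 0 + c * q 1) (-1) c p :=
    ((HasPartials.coord_zero.comp (hasDerivAt_neg _)).add
      ((HasPartials.const c).mul HasPartials.coord_one)).congr_partials (by simp) (by simp)
  have hE := hlin.comp (hasDerivAt_exp _)
  have hc := HasPartials.coord_one.comp (hasDerivAt_cos (p 1))
  have hs := HasPartials.coord_one.comp (hasDerivAt_sin (p 1))
  refine (((HasPartials.const a).add ((HasPartials.const d).mul (hE.mul hc))).add
    ((HasPartials.const e).mul (hE.mul hs))).congr_partials ?_ ?_ <;> ring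

/-- The first integrals of the system `u₀₀ = -u₀`, `u₀₁ = -u₁`, `u₁₁ = (1 + c²) u₀ + 2c u₁`. -/
theorem exists_eq_exp_trig {c : ℝ} {u : (Fin 2 → ℝ) → ℝ} (hu : ContDiff ℝ (⊤ : ℕ∞) u)
    (h00 : ∀ p, pd (pd u 0) 0 p = -pd u 0 p)
    (h01 : ∀ p, pd (pd u 1) 0 p = -pd u 1 p)
    (h11 : ∀ p, pd (pd u 1) 1 p = (1 + c ^ 2) * pd u 0 p + 2 * c * pd u 1 p) :
    ∃ a d e : ℝ, ∀ p, u p = a + d * (exp (-p 0 + c * p 1) * cos (p 1))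
      + e * (exp (-p 0 + c * p 1) * sin (p 1)) := by
  have h10 : ∀ p, pd (pd u 0) 1 p = -pd u 1 p := fun p => by rw [pd_pd_comm hu, h01]
  have hu0 : ∀ p, HasPartials (pd u 0) (-pd u 0 p) (-pd u 1 p) p := fun p =>
    ((hu.pd 0).hasPartials p).congr_partials (h00 p) (h10 p)
  have hu1 : ∀ p, HasPartials (pd u 1) (-pd u 1 p)
      ((1 + c ^ 2) * pd u 0 p + 2 * c * pd u 1 p) p := fun p =>
    ((hu.pd 1).hasPartials p).congr_partials (h01 p) (h11 p)
  have hE : ∀ p : Fin 2 → ℝ, HasPartials (fun q => exp (q 0 + (-c) * q 1))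
      (exp (p 0 + (-c) * p 1)) (-c * exp (p 0 + (-c) * p 1)) p := fun p =>
    ((HasPartials.coord_zero.add
      ((HasPartials.const (-c)).mul HasPartials.coord_one)).comp
        (hasDerivAt_exp _)).congr_partials (by ring) (by ring)
  have hc := fun p : Fin 2 → ℝ => HasPartials.coord_one.comp (hasDerivAt_cos (p 1))
  have hs := fun p : Fin 2 → ℝ => HasPartials.coord_one.comp (hasDerivAt_sin (p 1))
  have hw := fun p => (hu1 p).add ((HasPartials.const c).mul (hu0 p))
  have ha := eq_const_of_hasPartials_zero (fun p => ((hu.hasPartials p).add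
    (hu0 p)).congr_partials (by ring) (by ring))
  have hd := eq_const_of_hasPartials_zero (fun p => ((hE p).mul (((hu0 p).mul (hc p)).add
    ((hw p).mul (hs p)))).congr_partials (by ring) (by ring))
  have he := eq_const_of_hasPartials_zero (fun p => ((hE p).mul (((hu0 p).mul (hs p)).add
    ((hw p).mul ((HasPartials.const (-1)).mul (hc p))))).congr_partials (by ring) (by ring))
  refine ⟨u 0 + pd u 0 0, -pd u 0 0, pd u 1 0 + c * pd u 0 0, fun p => ?_⟩
  have hEE : exp (-p 0 + c * p 1) * exp (p 0 + (-c) * p 1) = 1 := by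
    rw [← exp_add, ← exp_zero]
    ring_nf
  have hd := hd p
  have he := he p
  simp only [Pi.zero_apply, mul_zero, add_zero, exp_zero, cos_zero, sin_zero] at hd he
  linear_combination ha p - hd * exp (-p 0 + c * p 1) * cos (p 1)
    - he * exp (-p 0 + c * p 1) * sin (p 1)
    + pd u 0 p * (cos (p 1) ^ 2 + sin (p 1) ^ 2) * hEE + pd u 0 p * sin_sq_add_cos_sq (p 1)

theorem stmt12 (c T1 : ℝ)
    (v : Fin 2 → (Fin 2 → ℝ) → ℝ)
    (hv : ∀ i : Fin 2, ContDiff ℝ (⊤ : ℕ∞) (v i)) :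
    IsAffineKilling Set.univ
      (fun i j k => fun _ : Fin 2 → ℝ =>
        ![![![(1 : ℝ), 0], ![T1, 0]], ![![-T1, 0], ![1 + c ^ 2, 2 * c]]] i j k) v
    ↔ ∃ a b d e : ℝ, ∀ p : Fin 2 → ℝ,
        v 0 p = a + d * (Real.exp (-p 0 + c * p 1) * Real.cos (p 1))
                  + e * (Real.exp (-p 0 + c * p 1) * Real.sin (p 1))
        ∧ v 1 p = b := by
  have hconst : ∀ (r : ℝ) (i : Fin 2) (p : Fin 2 → ℝ), pd (fun _ => r) i p = 0 := by
    intro r i p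
    simp [pd]
  constructor
  · intro h
    have hu := hv 0
    have hw := hv 1
    have k000 := fun p => h 0 0 0 p trivial
    have k010 := fun p => h 0 1 0 p trivial
    have k100 := fun p => h 1 0 0 p trivial
    have k110 := fun p => h 1 1 0 p trivial
    have k001 := fun p => h 0 0 1 p trivial
    have k011 := fun p => h 0 1 1 p trivial
    have k101 := fun p => h 1 0 1 p trivial
    simp [killingOp, hconst, Fin.sum_univ_two] at k000 k010 k100 k110 k001 k011 k101
    generalize v 0 = u at *
    generalize v 1 = w at *
    have hk : (1 + c ^ 2) ≠ 0 := by positivity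
    have hcu := pd_pd_comm hu 0 1
    have hcw := pd_pd_comm hw 0 1
    have e00 : ∀ p, pd (pd u 0) 0 p = -pd u 0 p := fun p => by linear_combination k000 p
    have e01 : ∀ p, pd (pd u 1) 0 p = -pd u 1 p - (1 + c ^ 2) * pd w 0 p := fun p => by
      linear_combination (k010 p + k100 p + hcu p) / 2
    have e10 : ∀ p, pd (pd u 0) 1 p = -pd u 1 p - (1 + c ^ 2) * pd w 0 p := fun p => by
      rw [← hcu, e01]
    have e11 : ∀ p, pd (pd u 1) 1 p =
        (1 + c ^ 2) * pd u 0 p + 2 * c * pd u 1 p - 2 * (1 + c ^ 2) * pd w 1 p := fun p => by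
      linear_combination k110 p
    have f00 : ∀ p, pd (pd w 0) 0 p = pd w 0 p := fun p => by linear_combination k001 p
    have f01 : ∀ p, pd (pd w 1) 0 p = -2 * c * pd w 0 p := fun p => by
      linear_combination (k011 p + k101 p + hcw p) / 2
    have hm := fun (r : ℝ) p => HasPartials.const (p := p) r
    have pu0 := fun p => (hu.pd 0).hasPartials p
    have pu1 := fun p => (hu.pd 1).hasPartials p
    have pw0 := fun p => (hw.pd 0).hasPartials p
    have pw1 := fun p => (hw.pd 1).hasPartials p
    have w0 : ∀ p, pd w 0 p = 0 := by
      intro p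
      have h1 := pd_pd_comm (hu.pd 0) 0 1 p
      have s1 : pd (pd u 0) 1 = fun p => (-1) * pd u 1 p + (-(1 + c ^ 2)) * pd w 0 p := by
        funext q; rw [e10]; ring
      have s2 : pd (pd u 0) 0 = fun p => (-1) * pd u 0 p := by
        funext q; rw [e00]; ring
      rw [s1, s2, (((hm _ p).mul (pu1 p)).add ((hm _ p).mul (pw0 p))).pd_zero,
        ((hm _ p).mul (pu0 p)).pd_one, e01, e10, f00] at h1
      apply mul_left_cancel₀ hk
      linear_combination -h1
    have w1 : ∀ p, pd w 1 p = 0 := by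
      intro p
      have h1 := pd_pd_comm (hu.pd 1) 0 1 p
      have s1 : pd (pd u 1) 1 = fun p => (1 + c ^ 2) * pd u 0 p + (2 * c) * pd u 1 p
          + (-2 * (1 + c ^ 2)) * pd w 1 p := by
        funext q; rw [e11]; ring
      have s2 : pd (pd u 1) 0 = fun p => (-1) * pd u 1 p := by
        funext q; rw [e01, w0]; ring
      rw [s1, s2, ((((hm _ p).mul (pu0 p)).add ((hm _ p).mul (pu1 p))).add
        ((hm _ p).mul (pw1 p))).pd_zero,
        ((hm _ p).mul (pu1 p)).pd_one, e00, e01, e11, f01, w0] at h1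
      apply mul_left_cancel₀ hk
      linear_combination -h1 / 2
    obtain ⟨a, d, e, hade⟩ := exists_eq_exp_trig (c := c) hu e00
      (fun p => by rw [e01, w0]; ring) (fun p => by rw [e11, w1]; ring)
    exact ⟨a, w 0, d, e, fun p => ⟨hade p, eq_const_of_hasPartials_zero
      (fun q => (hw.hasPartials q).congr_partials (w0 q) (w1 q)) p⟩⟩
  · rintro ⟨a, b, d, e, h⟩
    have hu : v 0 = _ := funext fun p => (h p).1
    have hw : v 1 = _ := funext fun p => (h p).2
    have p0 := fun a d e => funext fun p => (hasPartials_exp_trig c a d e p).pd_zero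
    have p1 := fun a d e => funext fun p => (hasPartials_exp_trig c a d e p).pd_one
    intro i j k p _
    fin_cases i <;> fin_cases j <;> fin_cases k <;>
      simp only [killingOp, Fin.sum_univ_two, Fin.zero_eta, Fin.mk_one, hconst, hu, hw, p0, p1] <;>
      simp <;> ring
end
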